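/- Let G = (V, E) be a block graph with |V| ≥ 3 and boundary δΩ. Let D be the maximum degree of G and let B be the maximum size of the blocks in G, and assume B(D − 1) ≥ 2. Then λ₂(G, δΩ) ≤ B² (B − 1) (D − 1)² / ( (B(D − 1) − 1) · |δΩ| ). -/

import Mathlib

open Finset

variable {V : Type*}

/-- The Dirichlet energy `∑_{{x,y} ∈ E} (f(x) - f(y))²` of a function on the vertices. -/
noncomputable def graphEnergy [Fintype V] (G : SimpleGraph V) (f : V → ℝ) : ℝ :=
  ∑ e ∈ G.edgeSet.toFinite.toFinset,
    Sym2.lift ⟨fun x y => (f x - f y) ^ 2, fun _ _ => by ring⟩ e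

/-- The first non-trivial Steklov eigenvalue `λ₂(G, δΩ)`. -/
noncomputable def steklovLambda2 [Fintype V] (G : SimpleGraph V) (B : Finset V) : ℝ :=
  sInf {r | ∃ f : V → ℝ, ∑ x ∈ B, f x = 0 ∧ (∃ x ∈ B, f x ≠ 0) ∧
    r = graphEnergy G f / ∑ x ∈ B, f x ^ 2}

/-- A set `S` of at least two vertices induces a connected subgraph without cut vertices
(for `|S| ≥ 3` this is 2-connectedness; a single edge also qualifies). -/
def HasNoCutVertex (G : SimpleGraph V) (S : Set V) : Prop :=
  2 ≤ S.ncard ∧ (G.induce S).Connected ∧ ∀ v ∈ S, (G.induce (S \ {v})).Connected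

/-- `S` is the vertex set of a block of `G`: a maximal 2-connected subgraph
(a single edge with its two endpoints counts as a block). -/
def IsBlockOf (G : SimpleGraph V) (S : Set V) : Prop :=
  HasNoCutVertex G S ∧ ∀ T : Set V, S ⊆ T → HasNoCutVertex G T → T = S

/-- A block graph is a connected graph in which every block is a complete graph. -/
def IsBlockGraph (G : SimpleGraph V) : Prop :=
  G.Connected ∧ ∀ S : Set V, IsBlockOf G S → ∀ x ∈ S, ∀ y ∈ S, x ≠ y → G.Adj x y

/-- The vertices reachable from `u` by a walk avoiding `x`. -/
def avoidComp (G : SimpleGraph V) (x u : V) : Set V :=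
  {y | ∃ p : G.Walk u y, x ∉ p.support}

lemma reachable_induce_of_walk (G : SimpleGraph V) {T : Set V} {a b : V} (p : G.Walk a b)
    (hp : ∀ w ∈ p.support, w ∈ T) (ha : a ∈ T) (hb : b ∈ T) :
    (G.induce T).Reachable ⟨a, ha⟩ ⟨b, hb⟩ :=
  ⟨p.induce T hp⟩

lemma connected_induce_of_walks (G : SimpleGraph V) {T : Set V} {a : V} (ha : a ∈ T)
    (h : ∀ b ∈ T, ∃ p : G.Walk a b, ∀ w ∈ p.support, w ∈ T) : (G.induce T).Connected := by
  rw [SimpleGraph.connected_iff_exists_forall_reachable]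
  refine ⟨⟨a, ha⟩, fun ⟨b, hb⟩ => ?_⟩
  obtain ⟨p, hp⟩ := h b hb
  exact reachable_induce_of_walk G p hp ha hb

lemma exists_isBlockOf_superset [Finite V] (G : SimpleGraph V) {S : Set V}
    (hS : HasNoCutVertex G S) : ∃ T, S ⊆ T ∧ IsBlockOf G T := by
  obtain ⟨T, hST, hT⟩ := (Set.toFinite {T : Set V | HasNoCutVertex G T}).exists_le_maximal hS
  exact ⟨T, hST, hT.prop, fun U hTU hU => (hT.le_of_ge hU hTU).antisymm hTU⟩

lemma hasNoCutVertex_of_clique [Finite V] (G : SimpleGraph V) {S : Set V} (hcard : 2 ≤ S.ncard)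
    (hS : ∀ x ∈ S, ∀ y ∈ S, x ≠ y → G.Adj x y) : HasNoCutVertex G S := by
  have key : ∀ T ⊆ S, T.Nonempty → (G.induce T).Connected := by
    rintro T hTS ⟨a, ha⟩
    refine connected_induce_of_walks G ha fun b hb => ?_
    by_cases hab : a = b
    · subst hab
      exact ⟨.nil, by simpa using ha⟩
    · refine ⟨(hS a (hTS ha) b (hTS hb) hab).toWalk, ?_⟩
      simp [ha, hb]
  have hlt : 1 < S.ncard := hcard
  refine ⟨hcard, key S subset_rfl (Set.nonempty_of_ncard_ne_zero (by omega)), fun v _ => ?_⟩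
  obtain ⟨w, hw, hwv⟩ := Set.exists_ne_of_one_lt_ncard hlt v
  exact key _ Set.sdiff_subset ⟨w, hw, hwv⟩

/-- A vertex together with a path between two of its neighbours avoiding it spans a subgraph
without cut vertices. -/
lemma hasNoCutVertex_insert_path [Finite V] (G : SimpleGraph V) {x y z : V} (hxy : G.Adj x y)
    (hxz : G.Adj x z) (p : G.Walk y z) (hp : p.IsPath) (hx : x ∉ p.support) :
    HasNoCutVertex G (insert x {w | w ∈ p.support}) := by
  classical
  refine ⟨?_, ?_, ?_⟩
  · rw [← Set.ncard_pair hxy.ne]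
    refine Set.ncard_le_ncard ?_ (Set.toFinite _)
    rintro w (rfl | rfl)
    · exact Or.inl rfl
    · exact Or.inr p.start_mem_support
  · refine connected_induce_of_walks G (Set.mem_insert x _) fun b hb => ?_
    rcases hb with rfl | hb
    · exact ⟨.nil, by simp⟩
    · refine ⟨.cons hxy (p.takeUntil b hb), fun w hw => ?_⟩
      rcases List.mem_cons.1 (by simpa using hw) with rfl | hw
      · exact Or.inl rfl
      · exact Or.inr (p.support_takeUntil_subset_support hb hw)
  · intro v hv
    by_cases hvx : v = x
    · subst hvx
      have hT : insert v {w | w ∈ p.support} \ {v} = {w | w ∈ p.support} :=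
        Set.insert_sdiff_self_of_notMem (a := v) (s := {w | w ∈ p.support}) hx
      rw [hT]
      exact p.connected_induce_support
    have hvp : v ∈ p.support := hv.resolve_left hvx
    refine connected_induce_of_walks G (a := x) ⟨Set.mem_insert x _, fun h => hvx h.symm⟩ ?_
    rintro b ⟨hb, hbv⟩
    rcases hb with rfl | hb
    · exact ⟨.nil, by simpa using fun h => hvx h.symm⟩
    by_cases hvt : v ∈ (p.takeUntil b hb).support
    · have hvd : v ∉ (p.dropUntil b hb).support := by
        intro hvd
        have hpp := hp
        rw [← p.take_spec hb, SimpleGraph.Walk.isPath_def, SimpleGraph.Walk.support_append,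
          List.nodup_append] at hpp
        refine hpp.2.2 v hvt v ?_ rfl
        rw [← SimpleGraph.Walk.cons_tail_support] at hvd
        exact (List.mem_cons.1 hvd).resolve_left fun h => hbv h.symm
      refine ⟨.cons hxz (p.dropUntil b hb).reverse, fun w hw => ?_⟩
      rcases List.mem_cons.1 (by simpa using hw) with rfl | hw
      · exact ⟨Or.inl rfl, fun h => hvx h.symm⟩
      · have hw' : w ∈ (p.dropUntil b hb).support := by simpa using hw
        exact ⟨Or.inr (p.support_dropUntil_subset_support hb hw'), fun h => hvd (h ▸ hw')⟩
    · refine ⟨.cons hxy (p.takeUntil b hb), fun w hw => ?_⟩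
      rcases List.mem_cons.1 (by simpa using hw) with rfl | hw
      · exact ⟨Or.inl rfl, fun h => hvx h.symm⟩
      · exact ⟨Or.inr (p.support_takeUntil_subset_support hb hw), fun h => hvt (h ▸ hw)⟩

lemma IsBlockGraph.adj_of_walk [Finite V] {G : SimpleGraph V} (hG : IsBlockGraph G) {x y z : V}
    (hxy : G.Adj x y) (hxz : G.Adj x z) (hyz : y ≠ z) (p : G.Walk y z) (hx : x ∉ p.support) :
    G.Adj y z := by
  classical
  obtain ⟨T, hST, hT⟩ := exists_isBlockOf_superset G
    (hasNoCutVertex_insert_path G hxy hxz p.bypass p.bypass_isPath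
      fun h => hx (p.support_bypass_subset_support h))
  exact hG.2 T hT y (hST (Or.inr (SimpleGraph.Walk.start_mem_support _))) z
    (hST (Or.inr (SimpleGraph.Walk.end_mem_support _))) hyz

lemma mem_avoidComp_symm {G : SimpleGraph V} {x a b : V} (h : b ∈ avoidComp G x a) :
    a ∈ avoidComp G x b := by
  obtain ⟨p, hp⟩ := h
  exact ⟨p.reverse, by simpa using hp⟩

lemma mem_avoidComp_trans {G : SimpleGraph V} {x a b c : V} (h : b ∈ avoidComp G x a)
    (h' : c ∈ avoidComp G x b) : c ∈ avoidComp G x a := by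
  obtain ⟨p, hp⟩ := h
  obtain ⟨q, hq⟩ := h'
  exact ⟨p.append q, by simp [SimpleGraph.Walk.mem_support_append_iff, hp, hq]⟩

lemma mem_avoidComp_self {G : SimpleGraph V} {x a : V} (h : x ≠ a) : a ∈ avoidComp G x a :=
  ⟨.nil, by simpa using h⟩

lemma notMem_avoidComp {G : SimpleGraph V} {x u : V} : x ∉ avoidComp G x u :=
  fun ⟨p, hp⟩ => hp p.end_mem_support

lemma mem_avoidComp_of_adj {G : SimpleGraph V} {x u a b : V} (ha : a ∈ avoidComp G x u)
    (hab : G.Adj a b) (hb : b ≠ x) : b ∈ avoidComp G x u := by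
  refine mem_avoidComp_trans ha ⟨hab.toWalk, ?_⟩
  have : a ≠ x := fun h => notMem_avoidComp (h ▸ ha)
  simp [hb.symm, this.symm]

lemma mem_avoidComp_of_dist_lt {G : SimpleGraph V} (hG : G.Connected) {x a y : V}
    (h : G.dist a y < G.dist x y) : y ∈ avoidComp G x a := by
  classical
  obtain ⟨p, hp⟩ := hG.exists_walk_length_eq_dist a y
  refine ⟨p, fun hx => ?_⟩
  have h1 := SimpleGraph.dist_le (p.dropUntil x hx)
  have h2 := p.length_dropUntil_le_length hx
  omega

lemma exists_adj_dist_add_one {G : SimpleGraph V} (hG : G.Connected) {x y : V} (h : x ≠ y) :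
    ∃ v, G.Adj x v ∧ G.dist v y + 1 = G.dist x y := by
  obtain ⟨p, hp⟩ := hG.exists_walk_length_eq_dist x y
  cases p with
  | nil => exact absurd rfl h
  | @cons _ v _ hv q =>
    refine ⟨v, hv, ?_⟩
    have h1 := SimpleGraph.dist_le q
    have h2 := hG.dist_triangle (u := x) (v := v) (w := y)
    have h3 : G.dist x v = 1 := SimpleGraph.dist_eq_one_iff_adj.2 hv
    simp only [SimpleGraph.Walk.length_cons] at hp
    omega

/-- In a block graph every vertex `y ≠ x` is separated from `x` by some neighbour of `x`. -/
lemma IsBlockGraph.exists_separating_neighbor [Finite V] {G : SimpleGraph V}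
    (hG : IsBlockGraph G) {x y : V} (h : x ≠ y) :
    ∃ v, G.Adj x v ∧ y ∈ avoidComp G x v ∧ y ∉ avoidComp G v x := by
  obtain ⟨v, hxv, hv⟩ := exists_adj_dist_add_one hG.1 h
  refine ⟨v, hxv, mem_avoidComp_of_dist_lt hG.1 (by omega), fun hy => ?_⟩
  have hvy : v ≠ y := fun e => notMem_avoidComp (e ▸ hy)
  obtain ⟨q, hvq, hq⟩ := exists_adj_dist_add_one hG.1 hvy
  have hyq : y ∈ avoidComp G v q := mem_avoidComp_of_dist_lt hG.1 (by omega)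
  obtain ⟨p, hp⟩ := mem_avoidComp_trans hy (mem_avoidComp_symm hyq)
  have hne : x ≠ q := by
    rintro rfl
    omega
  have hadj := hG.adj_of_walk hxv.symm hvq hne p hp
  have h2 := hG.1.dist_triangle (u := x) (v := q) (w := y)
  have h3 : G.dist x q = 1 := SimpleGraph.dist_eq_one_iff_adj.2 hadj
  omega

lemma IsBlockGraph.ncard_neighborSet_inter_avoidComp_lt [Finite V] {G : SimpleGraph V}
    (hG : IsBlockGraph G) {Bk : ℕ} (hBk : ∀ S : Set V, IsBlockOf G S → S.ncard ≤ Bk) {x u : V}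
    (hxu : G.Adj x u) : (G.neighborSet x ∩ avoidComp G x u).ncard + 1 ≤ Bk := by
  set N := G.neighborSet x ∩ avoidComp G x u with hN
  have hxN : x ∉ N := fun h => notMem_avoidComp h.2
  have hcard : (insert x N).ncard = N.ncard + 1 := Set.ncard_insert_of_notMem hxN (Set.toFinite _)
  have huN : u ∈ N := ⟨hxu, mem_avoidComp_self hxu.ne⟩
  have hpos : 0 < N.ncard := (Set.ncard_pos (Set.toFinite _)).2 ⟨u, huN⟩
  have hclique : ∀ a ∈ insert x N, ∀ b ∈ insert x N, a ≠ b → G.Adj a b := by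
    rintro a (rfl | ha) b (rfl | hb) hab
    · exact absurd rfl hab
    · exact hb.1
    · exact ha.1.symm
    · obtain ⟨p, hp⟩ := mem_avoidComp_trans (mem_avoidComp_symm ha.2) hb.2
      exact hG.adj_of_walk ha.1 hb.1 hab p hp
  obtain ⟨T, hST, hT⟩ := exists_isBlockOf_superset G
    (hasNoCutVertex_of_clique G (by omega) hclique)
  calc N.ncard + 1 = (insert x N).ncard := hcard.symm
    _ ≤ T.ncard := Set.ncard_le_ncard hST (Set.toFinite _)
    _ ≤ Bk := hBk T hT

lemma avoidComp_leaf [Fintype V] {G : SimpleGraph V} [DecidableRel G.Adj] {l x : V}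
    (hl : G.degree l = 1) (hlx : G.Adj x l) : avoidComp G x l = {l} := by
  ext y
  constructor
  · rintro ⟨p, hp⟩
    cases p with
    | nil => rfl
    | @cons _ v _ hv q =>
      obtain ⟨w, hw⟩ := Finset.card_eq_one.1 hl
      have h1 : v = w := by simpa [hw] using (G.mem_neighborFinset l v).2 hv
      have h2 : x = w := by simpa [hw] using (G.mem_neighborFinset l x).2 hlx.symm
      refine absurd ?_ hp
      rw [h2, ← h1]
      simp
  · rintro rfl
    exact mem_avoidComp_self hlx.ne

open Classical in
/-- A block graph has a vertex-component cut in which both sides hold at least a `1/N` fraction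
of the boundary, as soon as `N ≥ max 2 D`. -/
lemma IsBlockGraph.exists_balanced_cut [Fintype V] {G : SimpleGraph V} [DecidableRel G.Adj]
    (hG : IsBlockGraph G) {bd : Finset V} (hleaf : ∀ x ∈ bd, G.degree x = 1)
    (hbd : 2 ≤ bd.card) {N : ℕ} (hN : 2 ≤ N) (hdeg : ∀ v, G.degree v ≤ N) :
    ∃ x u, G.Adj x u ∧ bd.card ≤ N * (bd.filter (· ∈ avoidComp G x u)).card ∧
      bd.card ≤ N * (bd.filter (· ∉ avoidComp G x u)).card := by
  by_contra! hcon
  have hsplit : ∀ x u, (bd.filter (· ∈ avoidComp G x u)).card +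
      (bd.filter (· ∉ avoidComp G x u)).card = bd.card := fun x u =>
    Finset.card_filter_add_card_filter_not _
  let P : Set (V × V) :=
    {q | G.Adj q.1 q.2 ∧ N * (bd.filter (· ∈ avoidComp G q.1 q.2)).card < bd.card}
  have hP : P.Nonempty := by
    obtain ⟨l, hl⟩ : bd.Nonempty := Finset.card_pos.1 (by omega)
    obtain ⟨x, hx⟩ := (G.degree_pos_iff_exists_adj l).1 (by rw [hleaf l hl]; exact one_pos)
    refine ⟨(x, l), hx.symm, ?_⟩
    have hone : (bd.filter (· ∈ avoidComp G x l)).card = 1 := by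
      rw [avoidComp_leaf (hleaf l hl) hx.symm, Finset.card_eq_one]
      exact ⟨l, by ext y; simp only [Finset.mem_filter, Set.mem_singleton_iff,
        Finset.mem_singleton]; exact ⟨fun h => h.2, fun h => ⟨h ▸ hl, h⟩⟩⟩
    by_contra! hge
    have hlt := hcon x l hx.symm hge
    have h1 := hsplit x l
    rw [hone] at h1
    nlinarith
  obtain ⟨⟨x, u⟩, ⟨hxu, hsmall⟩, hmax⟩ :=
    Set.exists_max_image P (fun q => (avoidComp G q.1 q.2).ncard) (Set.toFinite _) hP
  dsimp only at hxu hsmall hmax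
  have hxbd : x ∉ bd := by
    intro hx
    obtain ⟨w, hw⟩ := Finset.card_eq_one.1 (hleaf x hx)
    have hsub : bd.filter (· ∉ avoidComp G x u) ⊆ {x} := by
      intro y hy
      rw [Finset.mem_filter] at hy
      rw [Finset.mem_singleton]
      by_contra hyx
      obtain ⟨v, hv, hyv, -⟩ := hG.exists_separating_neighbor (x := x) (y := y) (Ne.symm hyx)
      have h1 : v = w := by simpa [hw] using (G.mem_neighborFinset x v).2 hv
      have h2 : u = w := by simpa [hw] using (G.mem_neighborFinset x u).2 hxu
      exact hy.2 (by rw [h2, ← h1]; exact hyv)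
    have h1 := Finset.card_le_card hsub
    rw [Finset.card_singleton] at h1
    have h2 := hsplit x u
    nlinarith
  set W := (G.neighborFinset x).filter (· ∉ avoidComp G x u) with hW
  have hWcard : W.card + 1 ≤ N := by
    refine le_trans ?_ (hdeg x)
    refine Finset.card_lt_card (Finset.filter_ssubset.2 ⟨u, ?_, ?_⟩)
    · simpa using hxu
    · exact not_not.2 (mem_avoidComp_self hxu.ne)
  have hpiece : ∀ v ∈ W, N * (bd.filter (· ∉ avoidComp G v x)).card ≤ bd.card := by
    intro v hv
    rw [hW, Finset.mem_filter, SimpleGraph.mem_neighborFinset] at hv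
    obtain ⟨hxv, hvu⟩ := hv
    refine (hcon v x hxv.symm ?_).le
    by_contra! hlt
    have hle := hmax (v, x) ⟨hxv.symm, hlt⟩
    have hss : avoidComp G x u ⊂ avoidComp G v x := by
      refine ⟨?_, fun h => notMem_avoidComp (h (mem_avoidComp_self hxv.ne.symm))⟩
      rintro w ⟨p, hp⟩
      refine ⟨.cons hxu p, fun hvp => ?_⟩
      rcases List.mem_cons.1 (by simpa using hvp) with rfl | hvp
      · exact G.irrefl hxv
      · exact hvu ⟨p.takeUntil v hvp, fun h => hp (p.support_takeUntil_subset_support hvp h)⟩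
    exact absurd hle (not_le.2 (Set.ncard_lt_ncard hss (Set.toFinite _)))
  have hcover : bd.filter (· ∉ avoidComp G x u) ⊆
      W.biUnion fun v => bd.filter (· ∉ avoidComp G v x) := by
    intro y hy
    rw [Finset.mem_filter] at hy
    obtain ⟨v, hv, hyv, hyv'⟩ := hG.exists_separating_neighbor (x := x) (y := y)
      fun h => hxbd (h ▸ hy.1)
    rw [Finset.mem_biUnion]
    refine ⟨v, ?_, Finset.mem_filter.2 ⟨hy.1, hyv'⟩⟩
    rw [hW, Finset.mem_filter, SimpleGraph.mem_neighborFinset]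
    exact ⟨hv, fun h => hy.2 (mem_avoidComp_trans h hyv)⟩
  have hsum : N * (bd.filter (· ∉ avoidComp G x u)).card ≤ W.card * bd.card := by
    calc N * (bd.filter (· ∉ avoidComp G x u)).card
        ≤ N * ∑ v ∈ W, (bd.filter (· ∉ avoidComp G v x)).card :=
          Nat.mul_le_mul_left _ ((Finset.card_le_card hcover).trans Finset.card_biUnion_le)
      _ = ∑ v ∈ W, N * (bd.filter (· ∉ avoidComp G v x)).card := Finset.mul_sum _ _ _
      _ ≤ W.card * bd.card := by
          simpa using Finset.sum_le_card_nsmul W _ _ hpiece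
  have h2 := hsplit x u
  nlinarith

open Classical in
/-- The energy of a function taking only two values, constant on a component of `G - x` and on
its complement. -/
lemma graphEnergy_avoidComp_le [Fintype V] (G : SimpleGraph V) (x u : V) (a b : ℝ) :
    graphEnergy G (fun y => if y ∈ avoidComp G x u then a else b) ≤
      (G.neighborSet x ∩ avoidComp G x u).ncard * (a - b) ^ 2 := by
  set M := (Set.toFinite (G.neighborSet x ∩ avoidComp G x u)).toFinset with hM
  have hMc : (G.neighborSet x ∩ avoidComp G x u).ncard = M.card :=
    Set.ncard_eq_toFinset_card _ _
  unfold graphEnergy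
  set F : Sym2 V → ℝ := fun e => Sym2.lift ⟨fun y z =>
    ((if y ∈ avoidComp G x u then a else b) - (if z ∈ avoidComp G x u then a else b)) ^ 2,
    fun _ _ => by ring⟩ e with hF
  have hF0 : ∀ e, 0 ≤ F e := by
    intro e
    induction e with
    | _ y z => exact sq_nonneg _
  have hFle : ∀ e, F e ≤ (a - b) ^ 2 := by
    intro e
    induction e with
    | _ y z =>
      simp only [hF, Sym2.lift_mk]
      split_ifs <;> nlinarith [sq_nonneg (a - b)]
  have hzero : ∀ e ∈ G.edgeSet.toFinite.toFinset, e ∉ M.image (fun v => s(x, v)) → F e = 0 := by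
    intro e he hne
    have key : ∀ y z, G.Adj y z → s(y, z) ∉ M.image (fun v => s(x, v)) →
        y ∈ avoidComp G x u → z ∈ avoidComp G x u := by
      intro y z hyz hn hy
      refine mem_avoidComp_of_adj hy hyz ?_
      rintro rfl
      refine hn (Finset.mem_image.2 ⟨y, ?_, Sym2.eq_swap⟩)
      simpa [hM] using ⟨hyz.symm, hy⟩
    induction e with
    | _ y z =>
      have hyz : G.Adj y z := by simpa using he
      have h1 := key y z hyz hne
      have h2 := key z y hyz.symm (by rwa [Sym2.eq_swap])
      have h3 : y ∈ avoidComp G x u ↔ z ∈ avoidComp G x u := ⟨h1, h2⟩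
      simp [hF, h3]
  calc ∑ e ∈ G.edgeSet.toFinite.toFinset, F e
      ≤ ∑ e ∈ M.image (fun v => s(x, v)), F e := by
        rw [← Finset.sum_filter_add_sum_filter_not _ (· ∈ M.image (fun v => s(x, v))),
          Finset.sum_eq_zero (s := Finset.filter (· ∉ M.image (fun v => s(x, v))) _), add_zero]
        · exact Finset.sum_le_sum_of_subset_of_nonneg
            (fun e he => (Finset.mem_filter.1 he).2) fun e _ _ => hF0 e
        · intro e he
          rw [Finset.mem_filter] at he
          exact hzero e he.1 he.2
    _ ≤ (M.image (fun v => s(x, v))).card * (a - b) ^ 2 := by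
        rw [← nsmul_eq_mul]
        exact Finset.sum_le_card_nsmul _ _ _ fun e _ => hFle e
    _ ≤ M.card * (a - b) ^ 2 := by
        gcongr
        exact Finset.card_image_le
    _ = _ := by rw [hMc]

lemma graphEnergy_nonneg [Fintype V] (G : SimpleGraph V) (f : V → ℝ) : 0 ≤ graphEnergy G f := by
  refine Finset.sum_nonneg fun e _ => ?_
  induction e with
  | _ y z => exact sq_nonneg _

lemma steklovLambda2_le [Fintype V] (G : SimpleGraph V) (bd : Finset V) (f : V → ℝ)
    (h0 : ∑ x ∈ bd, f x = 0) (hf : ∃ x ∈ bd, f x ≠ 0) :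
    steklovLambda2 G bd ≤ graphEnergy G f / ∑ x ∈ bd, f x ^ 2 := by
  refine csInf_le ⟨0, ?_⟩ ⟨f, h0, hf, rfl⟩
  rintro r ⟨g, -, -, rfl⟩
  exact div_nonneg (graphEnergy_nonneg G g) (Finset.sum_nonneg fun _ _ => sq_nonneg _)

open Classical in
/-- The eigenvalue bound given by a vertex-component cut splitting the boundary into parts of
sizes `k` and `l`. -/
lemma steklovLambda2_le_of_cut [Fintype V] (G : SimpleGraph V) (bd : Finset V) (x u : V)
    {k l : ℕ} (hk : (bd.filter (· ∈ avoidComp G x u)).card = k)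
    (hl : (bd.filter (· ∉ avoidComp G x u)).card = l) (hk0 : 0 < k) (hl0 : 0 < l) :
    steklovLambda2 G bd ≤
      (G.neighborSet x ∩ avoidComp G x u).ncard * (k + l : ℝ) / (k * l) := by
  have hkR : (0 : ℝ) < k := by exact_mod_cast hk0
  have hlR : (0 : ℝ) < l := by exact_mod_cast hl0
  set f : V → ℝ := fun y => if y ∈ avoidComp G x u then (l : ℝ) else -k with hf
  have hsum : ∑ y ∈ bd, f y = 0 := by
    simp only [hf, Finset.sum_ite, Finset.sum_const, hk, hl, nsmul_eq_mul]
    ring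
  have hsq : ∑ y ∈ bd, f y ^ 2 = k * l * (k + l) := by
    simp only [hf, ite_pow, Finset.sum_ite, Finset.sum_const, hk, hl, nsmul_eq_mul]
    ring
  have hne : ∃ y ∈ bd, f y ≠ 0 := by
    obtain ⟨y, hy⟩ := Finset.card_pos.1 (hk ▸ hk0)
    rw [Finset.mem_filter] at hy
    refine ⟨y, hy.1, ?_⟩
    simp only [hf, if_pos hy.2]
    exact hlR.ne'
  have hE := graphEnergy_avoidComp_le G x u (l : ℝ) (-k)
  refine (steklovLambda2_le G bd f hsum hne).trans ?_
  rw [hsq]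
  calc graphEnergy G f / (k * l * (k + l))
      ≤ (G.neighborSet x ∩ avoidComp G x u).ncard * ((l : ℝ) - -k) ^ 2 / (k * l * (k + l)) := by
        gcongr
    _ = _ := by
        field_simp
        ring

/-- For a block graph with maximum degree `D` and maximum block size `B` with `B(D-1) ≥ 2`,
`λ₂ ≤ B² (B - 1) (D - 1)² / ((B(D-1) - 1) |δΩ|)`. -/
theorem lambda2_block_graph_refined [Fintype V] (G : SimpleGraph V) [DecidableRel G.Adj]
    (bd : Finset V) (D Bk : ℕ)
    (hblock : IsBlockGraph G) (hV : 3 ≤ Fintype.card V)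
    (hleaf : ∀ x ∈ bd, G.degree x = 1) (hbd : 2 ≤ bd.card)
    (hD : G.maxDegree = D)
    (hBk : ∀ S : Set V, IsBlockOf G S → S.ncard ≤ Bk)
    (hBk' : ∃ S : Set V, IsBlockOf G S ∧ S.ncard = Bk)
    (hBD : 2 ≤ Bk * (D - 1)) :
    steklovLambda2 G bd ≤
      (Bk : ℝ) ^ 2 * ((Bk : ℝ) - 1) * ((D : ℝ) - 1) ^ 2 /
        (((Bk : ℝ) * ((D : ℝ) - 1) - 1) * bd.card) := by
  classical
  have hBk2 : 2 ≤ Bk := by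
    obtain ⟨S, hS, rfl⟩ := hBk'
    exact hS.1.1
  have hD2 : 2 ≤ D := by
    by_contra! h
    have : D - 1 = 0 := by omega
    simp [this] at hBD
  obtain ⟨m, rfl⟩ : ∃ m, D = m + 1 := ⟨D - 1, by omega⟩
  rw [Nat.add_sub_cancel] at hBD
  have hdeg : ∀ v, G.degree v ≤ Bk * m := by
    intro v
    have := G.degree_le_maxDegree v
    nlinarith
  obtain ⟨x, u, hxu, h1, h2⟩ := hblock.exists_balanced_cut hleaf hbd hBD hdeg
  have hsplit : (bd.filter (· ∈ avoidComp G x u)).card +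
      (bd.filter (· ∉ avoidComp G x u)).card = bd.card :=
    Finset.card_filter_add_card_filter_not _
  obtain ⟨k, hk⟩ : ∃ k, (bd.filter (· ∈ avoidComp G x u)).card = k := ⟨_, rfl⟩
  obtain ⟨l, hl⟩ : ∃ l, (bd.filter (· ∉ avoidComp G x u)).card = l := ⟨_, rfl⟩
  rw [hk] at h1 hsplit
  rw [hl] at h2 hsplit
  have hk0 : 0 < k := Nat.pos_of_ne_zero (by rintro rfl; omega)
  have hl0 : 0 < l := Nat.pos_of_ne_zero (by rintro rfl; omega)
  refine (steklovLambda2_le_of_cut G bd x u hk hl hk0 hl0).trans ?_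
  have hc := hblock.ncard_neighborSet_inter_avoidComp_lt hBk hxu
  rw [← hsplit] at h1 h2 ⊢
  generalize (G.neighborSet x ∩ avoidComp G x u).ncard = c at hc
  have hcR : (c : ℝ) + 1 ≤ Bk := by exact_mod_cast hc
  have h1R : (k : ℝ) + l ≤ Bk * m * k := by exact_mod_cast h1
  have h2R : (k : ℝ) + l ≤ Bk * m * l := by exact_mod_cast h2
  have hNR : (2 : ℝ) ≤ Bk * m := by exact_mod_cast hBD
  have hkR : (0 : ℝ) < k := by exact_mod_cast hk0
  have hlR : (0 : ℝ) < l := by exact_mod_cast hl0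
  have hm : ((m + 1 : ℕ) : ℝ) - 1 = m := by push_cast; ring
  rw [hm, Nat.cast_add]
  generalize hN : (Bk : ℝ) * m = N at *
  have hnum : (Bk : ℝ) ^ 2 * ((Bk : ℝ) - 1) * (m : ℝ) ^ 2 = (Bk - 1) * N ^ 2 := by
    rw [← hN]; ring
  have hbal : (N - 1) * ((k : ℝ) + l) ^ 2 ≤ N ^ 2 * (k * l) := by
    nlinarith [mul_nonneg (sub_nonneg.2 h1R) (sub_nonneg.2 h2R)]
  have hN1 : 0 < N - 1 := by linarith
  rw [hnum, div_le_div_iff₀ (by positivity) (by positivity)]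
  calc (c : ℝ) * (k + l) * ((N - 1) * (k + l)) = c * ((N - 1) * ((k : ℝ) + l) ^ 2) := by ring
    _ ≤ (Bk - 1) * (N ^ 2 * (k * l)) := by
        have hcB : (c : ℝ) ≤ Bk - 1 := by linarith
        exact mul_le_mul hcB hbal (by positivity) (c.cast_nonneg.trans hcB)
    _ = (Bk - 1) * N ^ 2 * (k * l) := by ring
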